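/- Fix an integer H ≥ 3 and let q ∈ ℤ₂ be a rational 2-adic integer, i.e., q = a + 2^k·b̄_{v,∞} for some a, k, b, v ∈ ℕ with a < 2^k, b < 2^v and v ≥ 1. Then the sequence of natural numbers n ↦ L_H(R_n(Φ(L_n(q)))) is eventually periodic: there exist N ∈ ℕ and h ∈ ℕ with h ≥ 1 such that L_H(R_{n+h}(Φ(L_{n+h}(q)))) = L_H(R_n(Φ(L_n(q)))) for all n ≥ N. -/

import Mathlib

noncomputable section

/-- The inverse of `3` in the ring of 2-adic integers. -/
def inv3 : ℤ_[2] := Ring.inverse 3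

/-- The `j`-th binary digit of a 2-adic integer (as `0` or `1`). -/
def dig (x : ℤ_[2]) (j : ℕ) : ℕ := if Nat.testBit (x.appr (j + 1)) j then 1 else 0

/-- The number of one digits of `x` in positions `< j`. -/
def digCount (x : ℤ_[2]) (j : ℕ) : ℕ := ∑ i ∈ Finset.range j, dig x i

/-- Bernstein's formula for the 3x+1 conjugacy map `Φ`:
if `x = ∑_i 2^{d_i}` with `d_0 < d_1 < ⋯`, then `Φ x = -∑_i 2^{d_i} 3^{-i}`. -/
def Phi (x : ℤ_[2]) : ℤ_[2] :=
  -∑' j : ℕ, (dig x j : ℤ_[2]) * 2 ^ j * inv3 ^ digCount x j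

/-- `L_k(x)`: the unique natural number `< 2^k` congruent to `x` mod `2^k`. -/
def Lk (k : ℕ) (x : ℤ_[2]) : ℕ := x.appr k

theorem two_pow_dvd_sub_appr (k : ℕ) (x : ℤ_[2]) :
    (2 : ℤ_[2]) ^ k ∣ x - (x.appr k : ℤ_[2]) := by
  have h := PadicInt.appr_spec k x
  rw [Ideal.mem_span_singleton] at h
  exact_mod_cast h

theorem exists_Rk (k : ℕ) (x : ℤ_[2]) :
    ∃ z : ℤ_[2], x = (x.appr k : ℤ_[2]) + 2 ^ k * z := by
  obtain ⟨c, hc⟩ := two_pow_dvd_sub_appr k x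
  exact ⟨c, by rw [← hc]; ring⟩

/-- `R_k(x)`: the unique 2-adic integer with `x = L_k(x) + 2^k · R_k(x)`. -/
def Rk (k : ℕ) (x : ℤ_[2]) : ℤ_[2] := (exists_Rk k x).choose

/-- `α(a)`: the number of ones in the binary expansion of `a`. -/
def alphaNat (a : ℕ) : ℕ := (Nat.bits a).count true

/-- `b̄_{v,∞} = b · ∑_{i=0}^∞ 2^{v i}` as a 2-adic integer. -/
def bbar (b v : ℕ) : ℤ_[2] := (b : ℤ_[2]) * ∑' i : ℕ, (2 : ℤ_[2]) ^ (v * i)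

/-- `b̄_{v,t} = b · ∑_{i=0}^{t-1} 2^{v i}` as a natural number. -/
def bbarFin (b v t : ℕ) : ℕ := b * ∑ i ∈ Finset.range t, 2 ^ (v * i)

/-- The farPoint `fP(x,k)`: the least `r` such that no 2-adic congruent to `x`
mod `2^k` is a fixed point of `Φ` mod `2^{k+r}`, and `∞` if no such `r` exists. -/
def fP (x k : ℕ) : ℕ∞ :=
  sInf ((↑) '' {r : ℕ | ∀ z : ℤ_[2],
    (2 : ℤ_[2]) ^ k ∣ z - (x : ℤ_[2]) → ¬ (2 : ℤ_[2]) ^ (k + r) ∣ Phi z - z})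

end

theorem aux_nat_of_dvd (k a b : ℕ) (ha : a < 2 ^ k) (hb : b < 2 ^ k)
    (h : (2 : ℤ_[2]) ^ k ∣ (a : ℤ_[2]) - b) : a = b := by
  have h1 : (2 : ℤ) ^ k ∣ (a : ℤ) - b := by
    have := (PadicInt.pow_p_dvd_int_iff (p := 2) k ((a : ℤ) - b)).1 (by push_cast; exact h)
    exact_mod_cast this
  have h2 : (a : ℤ) ≡ b [ZMOD ((2 ^ k : ℕ) : ℤ)] := by
    apply Int.ModEq.symm
    rw [Int.modEq_iff_dvd]
    exact_mod_cast h1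
  exact Nat.ModEq.eq_of_lt_of_lt (Int.natCast_modEq_iff.1 h2) ha hb

theorem aux_appr_lt (k : ℕ) (x : ℤ_[2]) : x.appr k < 2 ^ k := PadicInt.appr_lt x k

theorem aux_appr_unique (k l : ℕ) (x : ℤ_[2]) (hl : l < 2 ^ k)
    (h : (2 : ℤ_[2]) ^ k ∣ x - l) : x.appr k = l := by
  apply aux_nat_of_dvd k _ _ (aux_appr_lt k x) hl
  have := dvd_sub h (two_pow_dvd_sub_appr k x)
  convert this using 1
  ring

theorem aux_Rk_spec (k : ℕ) (x : ℤ_[2]) :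
    x = (x.appr k : ℤ_[2]) + 2 ^ k * Rk k x := (exists_Rk k x).choose_spec

theorem aux_Rk_unique (k l : ℕ) (x z : ℤ_[2]) (hl : l < 2 ^ k)
    (h : x = l + 2 ^ k * z) : Rk k x = z := by
  have h1 : x.appr k = l := aux_appr_unique k l x hl ⟨z, by rw [h]; ring⟩
  have h2 := aux_Rk_spec k x
  rw [h1] at h2
  have h3 : (2 : ℤ_[2]) ^ k * Rk k x = 2 ^ k * z := by
    have := h2.symm.trans h
    exact add_left_cancel this
  exact mul_left_cancel₀ (pow_ne_zero _ two_ne_zero) h3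

theorem aux_Lk_congr (H : ℕ) (x y : ℤ_[2]) (h : (2 : ℤ_[2]) ^ H ∣ x - y) :
    Lk H x = Lk H y := by
  apply aux_appr_unique H _ x (aux_appr_lt H y)
  have := dvd_add h (two_pow_dvd_sub_appr H y)
  convert this using 1
  ring

theorem aux_Rk_add (n : ℕ) (x w : ℤ_[2]) : Rk n (x + 2 ^ n * w) = Rk n x + w := by
  apply aux_Rk_unique n (x.appr n) _ _ (aux_appr_lt n x)
  conv_lhs => rw [aux_Rk_spec n x]
  ring

theorem aux_Rk_succ (n : ℕ) (x : ℤ_[2]) : Rk (n + 1) x = Rk 1 (Rk n x) := by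
  have h1 := aux_Rk_spec n x
  have h2 := aux_Rk_spec 1 (Rk n x)
  have l1 := aux_appr_lt n x
  have l2 := aux_appr_lt 1 (Rk n x)
  apply aux_Rk_unique (n + 1) (x.appr n + 2 ^ n * (Rk n x).appr 1)
  · rw [pow_succ]
    have : 2 ^ n * (Rk n x).appr 1 ≤ 2 ^ n * 1 := Nat.mul_le_mul_left _ (by omega)
    omega
  · conv_lhs => rw [h1, h2]
    push_cast
    ring

/-- rational 2-adic integers -/
def AuxRat (x : ℤ_[2]) : Prop := ∃ m p : ℤ, Odd m ∧ (m : ℤ_[2]) * x = p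

theorem AuxRat.int (p : ℤ) : AuxRat p := ⟨1, p, odd_one, by simp⟩

theorem AuxRat.add {x y : ℤ_[2]} (hx : AuxRat x) (hy : AuxRat y) : AuxRat (x + y) := by
  obtain ⟨m, p, hm, h⟩ := hx
  obtain ⟨m_two, p_two, hm_two, h_two⟩ := hy
  refine ⟨m * m_two, p * m_two + p_two * m, hm.mul hm_two, ?_⟩
  push_cast
  rw [← h, ← h_two]
  ring

theorem AuxRat.mul {x y : ℤ_[2]} (hx : AuxRat x) (hy : AuxRat y) : AuxRat (x * y) := by
  obtain ⟨m, p, hm, h⟩ := hx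
  obtain ⟨m_two, p_two, hm_two, h_two⟩ := hy
  refine ⟨m * m_two, p * p_two, hm.mul hm_two, ?_⟩
  push_cast
  rw [← h, ← h_two]
  ring

theorem AuxRat.of_mul {x : ℤ_[2]} (u : ℤ) (hu : Odd u) (h : AuxRat (u * x)) : AuxRat x := by
  obtain ⟨m, p, hm, h⟩ := h
  exact ⟨m * u, p, hm.mul hu, by push_cast; rw [mul_assoc]; exact h⟩

theorem AuxRat.pow {x : ℤ_[2]} (hx : AuxRat x) (n : ℕ) : AuxRat (x ^ n) := by
  induction n with
  | zero => simpa using AuxRat.int 1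
  | succ n ih => rw [pow_succ]; exact ih.mul hx

theorem AuxRat.sum {f : ℕ → ℤ_[2]} (h : ∀ i, AuxRat (f i)) (n : ℕ) :
    AuxRat (∑ i ∈ Finset.range n, f i) := by
  induction n with
  | zero => simpa using AuxRat.int 0
  | succ n ih => rw [Finset.sum_range_succ]; exact ih.add (h n)

theorem aux_inv3 : (3 : ℤ_[2]) * inv3 = 1 := by
  apply Ring.mul_inverse_cancel
  rw [PadicInt.isUnit_iff]
  by_contra hne
  have h1 : ‖((3 : ℤ) : ℤ_[2])‖ < 1 := lt_of_le_of_ne (PadicInt.norm_le_one _) (by simpa using hne)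
  rw [PadicInt.norm_int_lt_one_iff_dvd] at h1
  norm_num at h1

theorem AuxRat.inv3 : AuxRat inv3 := ⟨3, 1, by decide, by simpa using aux_inv3⟩

theorem aux_inv3_sub : (2 : ℤ_[2]) ∣ inv3 - 1 :=
  ⟨-inv3, by linear_combination aux_inv3⟩

theorem aux_inv3_pow (H s : ℕ) : (2 : ℤ_[2]) ^ H ∣ inv3 ^ (2 ^ H * s) - 1 := by
  have h := dvd_sub_pow_of_dvd_sub (p := 2) (R := ℤ_[2]) (a := inv3) (b := 1)
    (by exact_mod_cast aux_inv3_sub) H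
  have h2 : (2 : ℤ_[2]) ^ H ∣ inv3 ^ 2 ^ H - 1 := by
    refine dvd_trans (pow_dvd_pow _ (Nat.le_succ H)) ?_
    simpa using h
  rw [pow_mul]
  refine h2.trans ?_
  simpa using sub_dvd_pow_sub_pow (inv3 ^ 2 ^ H) 1 s

theorem aux_Rk_periodic (y : ℤ_[2]) (hy : AuxRat y) :
    ∃ N h : ℕ, 1 ≤ h ∧ ∀ n, N ≤ n → Rk (n + h) y = Rk n y := by
  obtain ⟨m, p, hm, h⟩ := hy
  have hm0 : (m : ℤ_[2]) ≠ 0 := by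
    intro h0
    have : m = 0 := by exact_mod_cast h0
    subst this
    exact absurd hm (by decide)
  have key : ∀ n, ∃ z : ℤ, z ∈ Finset.Icc (-(|p| + |m|)) (|p| + |m|) ∧
      (m : ℤ_[2]) * Rk n y = z := by
    intro n
    have h1 := aux_Rk_spec n y
    have l1 := aux_appr_lt n y
    have h2 : (2 : ℤ_[2]) ^ n * (m * Rk n y) = ((p - m * (y.appr n : ℤ) : ℤ) : ℤ_[2]) := by
      push_cast
      rw [← h]
      linear_combination (-(m : ℤ_[2])) * h1
    have h3 : (2 : ℤ) ^ n ∣ p - m * (y.appr n : ℤ) := by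
      have := (PadicInt.pow_p_dvd_int_iff (p := 2) n (p - m * (y.appr n : ℤ))).1
        ⟨m * Rk n y, by rw [← h2]; norm_num⟩
      exact_mod_cast this
    obtain ⟨z, hz⟩ := h3
    refine ⟨z, ?_, ?_⟩
    · rw [Finset.mem_Icc, ← abs_le]
      have hpos : (0 : ℤ) < 2 ^ n := by positivity
      have e1 : 2 ^ n * |z| = |p - m * (y.appr n : ℤ)| := by
        rw [hz, abs_mul, abs_of_pos hpos]
      have e2 : |p - m * (y.appr n : ℤ)| ≤ |p| + |m| * (y.appr n : ℤ) := by
        refine (abs_sub _ _).trans ?_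
        rw [abs_mul, Nat.abs_cast]
      have e3 : (y.appr n : ℤ) ≤ 2 ^ n := by exact_mod_cast l1.le
      have e4 : |m| * (y.appr n : ℤ) ≤ |m| * 2 ^ n := mul_le_mul_of_nonneg_left e3 (abs_nonneg _)
      have e5 : |p| ≤ |p| * 2 ^ n := le_mul_of_one_le_right (abs_nonneg _) (by omega)
      refine le_of_mul_le_mul_left ?_ hpos
      rw [e1]
      linarith
    · rw [hz] at h2
      push_cast at h2
      exact mul_left_cancel₀ (pow_ne_zero _ two_ne_zero) h2
  choose z hz1 hz2 using key
  obtain ⟨i, j, hij, hzz⟩ : ∃ i j, i < j ∧ z i = z j := by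
    obtain ⟨i, j, hne, he⟩ := Finite.exists_ne_map_eq_of_infinite
      (fun n => (⟨z n, hz1 n⟩ : (Finset.Icc (-(|p| + |m|)) (|p| + |m|) : Finset ℤ)))
    have he_two : z i = z j := by simpa using he
    rcases lt_or_gt_of_ne hne with hl | hl
    · exact ⟨i, j, hl, he_two⟩
    · exact ⟨j, i, hl, he_two.symm⟩
  have hR : Rk i y = Rk j y := by
    apply mul_left_cancel₀ hm0
    rw [hz2, hz2, hzz]
  refine ⟨i, j - i, by omega, fun n hn => ?_⟩
  induction n, hn using Nat.le_induction with
  | base => rw [show i + (j - i) = j by omega, hR]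
  | succ n hn ih =>
    rw [show n + 1 + (j - i) = (n + (j - i)) + 1 by omega, aux_Rk_succ, ih, ← aux_Rk_succ]

theorem aux_appr_nat (m k : ℕ) : (m : ℤ_[2]).appr k = m % 2 ^ k := by
  apply aux_appr_unique _ _ _ (Nat.mod_lt _ (by positivity))
  refine ⟨(m / 2 ^ k : ℕ), ?_⟩
  have : (m : ℤ_[2]) = ((2 ^ k * (m / 2 ^ k) + m % 2 ^ k : ℕ) : ℤ_[2]) := by
    rw [Nat.div_add_mod]
  conv_lhs => rw [this]
  push_cast
  ring

theorem aux_appr_mod (x : ℤ_[2]) (j n : ℕ) (h : j ≤ n) : x.appr n % 2 ^ j = x.appr j := by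
  symm
  apply aux_appr_unique _ _ _ (Nat.mod_lt _ (by positivity))
  have h1 := dvd_trans (pow_dvd_pow (2 : ℤ_[2]) h) (two_pow_dvd_sub_appr n x)
  have h2 := two_pow_dvd_sub_appr j (x.appr n : ℤ_[2])
  rw [aux_appr_nat] at h2
  convert dvd_add h1 h2 using 1
  ring

theorem aux_dig_Lk (q : ℤ_[2]) (n j : ℕ) :
    dig (Lk n q : ℕ) j = if j < n then dig q j else 0 := by
  unfold dig Lk
  rw [aux_appr_nat, Nat.testBit_mod_two_pow]
  split_ifs with h1 h2 h3 h3 h4 <;> try rfl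
  all_goals simp at h1
  · rw [← aux_appr_mod q (j + 1) n (by omega), Nat.testBit_mod_two_pow] at h3
    simp [h1] at h3
  · rw [Nat.testBit_lt_two_pow ((aux_appr_lt n q).trans_le
      (Nat.pow_le_pow_right (by norm_num) (by omega)))] at h1
    simp at h1
  · rw [← aux_appr_mod q (j + 1) n (by omega), Nat.testBit_mod_two_pow] at h4
    simp [h1] at h4

theorem aux_dig_shift (l k j : ℕ) (z : ℤ_[2]) (hl : l < 2 ^ k) :
    dig (l + 2 ^ k * z) (k + j) = dig z j := by
  have h : ((l : ℤ_[2]) + 2 ^ k * z).appr (k + j + 1) = 2 ^ k * z.appr (j + 1) + l := by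
    apply aux_appr_unique
    · have := aux_appr_lt (j + 1) z
      rw [add_assoc, pow_add]
      nlinarith
    · obtain ⟨c, hc⟩ := two_pow_dvd_sub_appr (j + 1) z
      refine ⟨c, ?_⟩
      push_cast
      rw [add_assoc, pow_add]
      linear_combination 2 ^ k * hc
  unfold dig
  rw [h, Nat.testBit_two_pow_mul_add _ hl]
  simp

theorem aux_summable (f : ℕ → ℤ_[2]) (h : ∀ j, (2 : ℤ_[2]) ^ j ∣ f j) : Summable f := by
  apply Summable.of_norm_bounded (g := fun j : ℕ => ((1 : ℝ) / 2) ^ j)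
    (summable_geometric_of_lt_one (by norm_num) (by norm_num))
  intro j
  obtain ⟨c, hc⟩ := h j
  rw [hc, norm_mul, norm_pow]
  have h2 : ‖(2 : ℤ_[2])‖ = 1 / 2 := by
    have := PadicInt.norm_p (p := 2)
    norm_num at this ⊢
    exact this
  rw [h2]
  exact mul_le_of_le_one_right (by positivity) (PadicInt.norm_le_one _)

theorem aux_bbar (b v : ℕ) (hv : 1 ≤ v) : bbar b v = b + 2 ^ v * bbar b v := by
  have hs : Summable (fun i : ℕ => (2 : ℤ_[2]) ^ (v * i)) :=
    aux_summable _ fun j => pow_dvd_pow _ (Nat.le_mul_of_pos_left j hv)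
  have h := hs.tsum_eq_zero_add
  have h2 : (fun i : ℕ => (2 : ℤ_[2]) ^ (v * (i + 1))) = fun i => 2 ^ v * 2 ^ (v * i) := by
    funext i
    rw [← pow_add]
    congr 1
    ring
  rw [h2, hs.tsum_mul_left] at h
  unfold bbar
  simp only [mul_zero, pow_zero] at h
  linear_combination (b : ℤ_[2]) * h

theorem aux_dig_periodic (a k b v : ℕ) (ha : a < 2 ^ k) (hb : b < 2 ^ v) (hv : 1 ≤ v) (n : ℕ)
    (hn : k ≤ n) : dig ((a : ℤ_[2]) + 2 ^ k * bbar b v) (n + v)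
      = dig ((a : ℤ_[2]) + 2 ^ k * bbar b v) n := by
  obtain ⟨j, rfl⟩ := Nat.exists_eq_add_of_le hn
  rw [add_assoc, aux_dig_shift _ _ _ _ ha, aux_dig_shift _ _ _ _ ha]
  conv_lhs => rw [aux_bbar b v hv, add_comm j v, aux_dig_shift _ _ _ _ hb]

/-- the tail series from a digit sequence -/
noncomputable def auxT (d : ℕ → ℕ) : ℤ_[2] :=
  ∑' j : ℕ, (d j : ℤ_[2]) * 2 ^ j * inv3 ^ (∑ i ∈ Finset.range j, d i)

theorem auxT_split (d : ℕ → ℕ) (n : ℕ) :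
    auxT d = ∑ j ∈ Finset.range n, (d j : ℤ_[2]) * 2 ^ j * inv3 ^ (∑ i ∈ Finset.range j, d i)
      + 2 ^ n * (inv3 ^ (∑ i ∈ Finset.range n, d i) * auxT (fun j => d (n + j))) := by
  have hs : Summable (fun j : ℕ => (d j : ℤ_[2]) * 2 ^ j * inv3 ^ (∑ i ∈ Finset.range j, d i)) :=
    aux_summable _ fun j => ⟨d j * inv3 ^ (∑ i ∈ Finset.range j, d i), by ring⟩
  unfold auxT
  rw [← hs.sum_add_tsum_nat_add n]
  congr 1
  have hs2 : Summable (fun j : ℕ => (d (n + j) : ℤ_[2]) * 2 ^ j *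
      inv3 ^ (∑ i ∈ Finset.range j, d (n + i))) :=
    aux_summable _ fun j => ⟨d (n + j) * inv3 ^ (∑ i ∈ Finset.range j, d (n + i)), by ring⟩
  rw [← mul_assoc, ← hs2.tsum_mul_left]
  congr 1
  funext j
  rw [add_comm j n, Finset.sum_range_add, pow_add, pow_add]
  ring

theorem aux_Phi_Lk (q : ℤ_[2]) (n : ℕ) : Phi (Lk n q : ℕ) =
    -∑ j ∈ Finset.range n, (dig q j : ℤ_[2]) * 2 ^ j * inv3 ^ (∑ i ∈ Finset.range j, dig q i) := by
  unfold Phi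
  congr 1
  rw [tsum_eq_sum (s := Finset.range n)]
  · apply Finset.sum_congr rfl
    intro j hj
    have hj := Finset.mem_range.1 hj
    have : digCount (Lk n q : ℕ) j = ∑ i ∈ Finset.range j, dig q i := by
      unfold digCount
      apply Finset.sum_congr rfl
      intro i hi
      have hi := Finset.mem_range.1 hi
      rw [aux_dig_Lk, if_pos (by omega)]
    rw [this, aux_dig_Lk, if_pos hj]
  · intro j hj
    rw [Finset.mem_range] at hj
    rw [aux_dig_Lk, if_neg hj]
    simp

theorem auxT_rat (d : ℕ → ℕ) (k v : ℕ) (hv : 1 ≤ v) (hd : ∀ n, k ≤ n → d (n + v) = d n) :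
    AuxRat (auxT d) := by
  have hpart : ∀ (e : ℕ → ℕ) (n : ℕ), AuxRat (∑ j ∈ Finset.range n,
      (e j : ℤ_[2]) * 2 ^ j * inv3 ^ (∑ i ∈ Finset.range j, e i)) := by
    intro e n
    apply AuxRat.sum
    intro j
    refine (AuxRat.mul ?_ ?_).mul (AuxRat.inv3.pow _)
    · exact_mod_cast AuxRat.int (e j)
    · exact_mod_cast AuxRat.int (2 ^ j)
  rw [auxT_split d k]
  refine (hpart d k).add (AuxRat.mul ?_ ((AuxRat.inv3.pow _).mul ?_))
  · exact_mod_cast AuxRat.int (2 ^ k)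
  set e : ℕ → ℕ := fun j => d (k + j) with he
  have hee : (fun j => e (v + j)) = e := by
    funext j
    simp only [he]
    rw [show k + (v + j) = k + j + v by ring]
    exact hd _ (by omega)
  have h := auxT_split e v
  rw [hee] at h
  set A := ∑ i ∈ Finset.range v, e i
  have h3 : (3 : ℤ_[2]) ^ A * inv3 ^ A = 1 := by rw [← mul_pow, aux_inv3, one_pow]
  apply AuxRat.of_mul (3 ^ A - 2 ^ v)
  · apply Odd.sub_even
    · exact Odd.pow (by decide)
    · exact (by decide : Even (2 : ℤ)).pow_of_ne_zero (by omega)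
  · have : (((3 ^ A - 2 ^ v : ℤ)) : ℤ_[2]) * auxT e = ((3 ^ A : ℤ) : ℤ_[2]) * ∑ j ∈ Finset.range v,
        (e j : ℤ_[2]) * 2 ^ j * inv3 ^ (∑ i ∈ Finset.range j, e i) := by
      push_cast
      linear_combination (3 : ℤ_[2]) ^ A * h + 2 ^ v * auxT e * h3
    rw [this]
    exact (AuxRat.int _).mul (hpart e v)

/-- For `H ≥ 3` and rational `q ∈ ℤ₂`, the sequence
`n ↦ L_H(R_n(Φ(L_n(q))))` is eventually periodic. -/
theorem stmt0 (H : ℕ) (hH : 3 ≤ H) (q : ℤ_[2])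
    (hq : ∃ a k b v : ℕ, a < 2 ^ k ∧ b < 2 ^ v ∧ 1 ≤ v ∧
      q = (a : ℤ_[2]) + 2 ^ k * bbar b v) :
    ∃ N h : ℕ, 1 ≤ h ∧ ∀ n : ℕ, N ≤ n →
      Lk H (Rk (n + h) (Phi (Lk (n + h) q))) = Lk H (Rk n (Phi (Lk n q))) := by
  obtain ⟨a, k, b, v, ha, hb, hv, hq⟩ := hq
  set d : ℕ → ℕ := fun n => dig q n with hd
  have hper : ∀ n, k ≤ n → d (n + v) = d n := by
    intro n hn
    simp only [hd, hq]
    exact aux_dig_periodic a k b v ha hb hv n hn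
  have hpers : ∀ s n, k ≤ n → d (n + v * s) = d n := by
    intro s
    induction s with
    | zero => intro n _; simp
    | succ s ih =>
      intro n hn
      rw [mul_add, mul_one, ← add_assoc, hper _ (by omega), ih n hn]
  have hcount : ∀ n, k ≤ n → ∀ s, ∑ i ∈ Finset.range (n + v * s), d i
      = ∑ i ∈ Finset.range n, d i + s * ∑ i ∈ Finset.range v, d (n + i) := by
    intro n hn s
    induction s with
    | zero => simp
    | succ s ih =>
      rw [mul_add, mul_one, ← add_assoc, Finset.sum_range_add, ih, add_mul, one_mul, add_assoc]
      congr 2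
      apply Finset.sum_congr rfl
      intro i _
      rw [show n + v * s + i = n + i + v * s by ring]
      exact hpers s _ (by omega)
  have hy : AuxRat (-auxT d) := by
    have := (AuxRat.int (-1)).mul (auxT_rat d k v hv hper)
    simpa using this
  obtain ⟨N, h, hh, hR⟩ := aux_Rk_periodic _ hy
  have hRs : ∀ s n, N ≤ n → Rk (n + h * s) (-auxT d) = Rk n (-auxT d) := by
    intro s
    induction s with
    | zero => intro n _; simp
    | succ s ih =>
      intro n hn
      rw [mul_add, mul_one, ← add_assoc, hR _ (by omega), ih n hn]
  have hmain : ∀ n, Rk n (Phi (Lk n q)) = Rk n (-auxT d)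
      + inv3 ^ (∑ i ∈ Finset.range n, d i) * auxT (fun j => d (n + j)) := by
    intro n
    rw [← aux_Rk_add, aux_Phi_Lk]
    congr 1
    linear_combination auxT_split d n
  refine ⟨max N k, h * (v * 2 ^ H), Nat.mul_pos hh (by positivity), fun n hn => ?_⟩
  have hN : N ≤ n := le_trans (le_max_left _ _) hn
  have hk : k ≤ n := le_trans (le_max_right _ _) hn
  apply aux_Lk_congr
  rw [hmain, hmain, hRs _ n hN]
  have e1 : h * (v * 2 ^ H) = v * (2 ^ H * h) := by ring
  have e2 : (fun j => d (n + h * (v * 2 ^ H) + j)) = fun j => d (n + j) := by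
    funext j
    rw [e1, show n + v * (2 ^ H * h) + j = n + j + v * (2 ^ H * h) by ring]
    exact hpers _ _ (by omega)
  rw [e2, e1, hcount n hk, pow_add, mul_assoc (2 ^ H) h]
  obtain ⟨c, hc⟩ := aux_inv3_pow H (h * ∑ i ∈ Finset.range v, d (n + i))
  refine ⟨inv3 ^ (∑ i ∈ Finset.range n, d i) * auxT (fun j => d (n + j)) * c, ?_⟩
  linear_combination inv3 ^ (∑ i ∈ Finset.range n, d i) * auxT (fun j => d (n + j)) * hc
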